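/- arXiv:2503.23041 — 4 statements merged into one kernel-verified Lean document; each statement's English description precedes it below -/
import Mathlib

section
/- F has exactly 12 subgroups of order 6, and every subgroup of F of order 6 is nonabelian (hence isomorphic to the symmetric group S₃). -/
/-- The homomorphism `ℤ/2ℤ →* MulAut A` sending the nontrivial element to inversion. -/
def invHom (A : Type*) [CommGroup A] : Multiplicative (ZMod 2) →* MulAut A where
  toFun x := (MulEquiv.inv A) ^ (Multiplicative.toAdd x).val
  map_one' := by simp
  map_mul' x y := by
    have h2 : (MulEquiv.inv A) ^ 2 = 1 := by
      ext a; simp [pow_succ]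
    have key : ∀ m : ℕ, (MulEquiv.inv A) ^ m = (MulEquiv.inv A) ^ (m % 2) :=
      fun m => pow_eq_pow_mod m h2
    show (MulEquiv.inv A) ^ (Multiplicative.toAdd (x*y)).val = _
    rw [show Multiplicative.toAdd (x*y) = Multiplicative.toAdd x + Multiplicative.toAdd y from rfl,
        ZMod.val_add, ← key, pow_add]

/-- The generalized dihedral group of a commutative group `A`:
the semidirect product `A ⋊ ℤ/2ℤ` where the nontrivial element of `ℤ/2ℤ` acts by inversion. -/
abbrev GenDihedral (A : Type*) [CommGroup A] :=
  SemidirectProduct A (Multiplicative (ZMod 2)) (invHom A)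

abbrev A33 := Multiplicative (ZMod 3 × ZMod 3)

/-- The image of `0` under a permutation of `Fin 3`, as an element of `ZMod 3`. -/
def imageZero (σ : Equiv.Perm (Fin 3)) : ZMod 3 := (show Fin 3 from σ 0)

/-- Every permutation of `Fin 3` is affine: a translation if even, a reflection if odd. -/
theorem imageZero_mul (σ τ : Equiv.Perm (Fin 3)) :
    imageZero (σ * τ) =
      if Equiv.Perm.sign σ = 1 then imageZero σ + imageZero τ
      else imageZero σ - imageZero τ := by
  revert σ τ; decide

theorem perm_fin_three_ext (σ τ : Equiv.Perm (Fin 3)) (h : imageZero σ = imageZero τ)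
    (hs : Equiv.Perm.sign σ = Equiv.Perm.sign τ) : σ = τ := by
  revert σ τ; decide

namespace GenDihedral

/-- The rotation (`e = 0`) or reflection (`e = 1`) with translation part `v`. -/
def mk (v : ZMod 3 × ZMod 3) (e : ZMod 2) : GenDihedral A33 :=
  ⟨Multiplicative.ofAdd v, Multiplicative.ofAdd e⟩

theorem mk_inj {v w : ZMod 3 × ZMod 3} {e f : ZMod 2} :
    mk v e = mk w f ↔ v = w ∧ e = f := by
  simp [mk, SemidirectProduct.ext_iff]

theorem exists_eq_mk (x : GenDihedral A33) : ∃ v e, x = mk v e :=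
  ⟨x.left.toAdd, x.right.toAdd, rfl⟩

theorem one_eq_mk : (1 : GenDihedral A33) = mk 0 0 := rfl

theorem mk_zero_mul (v w : ZMod 3 × ZMod 3) (e : ZMod 2) :
    mk v 0 * mk w e = mk (v + w) e := by
  ext1
  · rfl
  · exact congrArg Multiplicative.ofAdd (zero_add e)

theorem mk_one_mul (v w : ZMod 3 × ZMod 3) (e : ZMod 2) :
    mk v 1 * mk w e = mk (v - w) (1 + e) := by
  ext1
  · exact congrArg Multiplicative.ofAdd (sub_eq_add_neg v w).symm
  · rfl

theorem mk_one_mul_mk_one (v w : ZMod 3 × ZMod 3) : mk v 1 * mk w 1 = mk (v - w) 0 :=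
  mk_one_mul v w 1

/-- The embedding of `S₃`, as the affine group of `ZMod 3`, with rotations along `a` and
reflections in the coset of `b`. -/
def permHom (a b : ZMod 3 × ZMod 3) : Equiv.Perm (Fin 3) →* GenDihedral A33 :=
  MonoidHom.mk' (fun σ => if Equiv.Perm.sign σ = 1 then mk (imageZero σ • a) 0
      else mk (b + imageZero σ • a) 1) <| by
    intro σ τ
    simp only [imageZero_mul, Equiv.Perm.sign_mul]
    rcases Int.units_eq_one_or (Equiv.Perm.sign σ) with hs | hs <;>
    rcases Int.units_eq_one_or (Equiv.Perm.sign τ) with ht | ht <;>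
    simp only [hs, ht, mul_one, mul_neg, neg_neg, reduceIte, mk_zero_mul,
      mk_one_mul, add_zero, add_smul, sub_smul,
      show (-1 : ℤˣ) ≠ 1 by decide] <;>
    congr 1 <;> abel

theorem permHom_apply (a b : ZMod 3 × ZMod 3) (σ : Equiv.Perm (Fin 3)) :
    permHom a b σ = if Equiv.Perm.sign σ = 1 then mk (imageZero σ • a) 0
      else mk (b + imageZero σ • a) 1 := rfl

theorem permHom_injective {a : ZMod 3 × ZMod 3} (ha : a ≠ 0) (b : ZMod 3 × ZMod 3) :
    Function.Injective (permHom a b) := by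
  intro σ τ h
  rw [permHom_apply, permHom_apply] at h
  rcases Int.units_eq_one_or (Equiv.Perm.sign σ) with hs | hs <;>
  rcases Int.units_eq_one_or (Equiv.Perm.sign τ) with ht | ht <;>
  simp only [hs, ht, reduceIte, mk_inj, add_right_inj, show (-1 : ℤˣ) ≠ 1 by decide, show (1 : ZMod 2) ≠ 0 by decide,
    show (0 : ZMod 2) ≠ 1 by decide, and_true, and_false] at h
  all_goals
    exact perm_fin_three_ext σ τ (smul_left_injective (ZMod 3) ha h) (hs.trans ht.symm)

theorem mem_range_permHom {a b v : ZMod 3 × ZMod 3} {e : ZMod 2} :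
    mk v e ∈ (permHom a b).range ↔
      ∃ k : ZMod 3, e = 0 ∧ v = k • a ∨ e = 1 ∧ v = b + k • a := by
  have hp : ∀ k : ZMod 3, ∃ σ : Equiv.Perm (Fin 3), Equiv.Perm.sign σ = 1 ∧ imageZero σ = k := by
    decide
  have hn : ∀ k : ZMod 3, ∃ σ : Equiv.Perm (Fin 3), Equiv.Perm.sign σ ≠ 1 ∧ imageZero σ = k := by
    decide
  constructor
  · rintro ⟨σ, h⟩
    refine ⟨imageZero σ, ?_⟩
    rw [permHom_apply] at h
    split_ifs at h <;> simp only [mk_inj] at h <;> simp [← h.1, ← h.2]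
  · rintro ⟨k, ⟨rfl, rfl⟩ | ⟨rfl, rfl⟩⟩
    · obtain ⟨σ, hs, rfl⟩ := hp k
      exact ⟨σ, by rw [permHom_apply, if_pos hs]⟩
    · obtain ⟨σ, hs, rfl⟩ := hn k
      exact ⟨σ, by rw [permHom_apply, if_neg hs]⟩

theorem card_range_permHom {a : ZMod 3 × ZMod 3} (ha : a ≠ 0) (b : ZMod 3 × ZMod 3) :
    Nat.card (permHom a b).range = 6 := by
  rw [← Nat.card_congr (MonoidHom.ofInjective (permHom_injective ha b)).toEquiv]
  simp [Nat.card_eq_fintype_card, Fintype.card_perm, Nat.factorial]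

/-- A nonzero vector on each of the four lines of `ZMod 3 × ZMod 3`. -/
def lineGen : Fin 4 → ZMod 3 × ZMod 3 := ![(1, 0), (0, 1), (1, 1), (1, 2)]

/-- A vector outside each of the four lines of `ZMod 3 × ZMod 3`. -/
def lineCompl : Fin 4 → ZMod 3 × ZMod 3 := ![(0, 1), (1, 0), (1, 0), (1, 0)]

theorem lineGen_ne_zero (i : Fin 4) : lineGen i ≠ 0 := by revert i; decide

/-- The subgroup of order six attached to a line and one of its three cosets. -/
def lineSubgroup (p : Fin 4 × ZMod 3) : Subgroup (GenDihedral A33) :=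
  (permHom (lineGen p.1) (p.2 • lineCompl p.1)).range

theorem card_lineSubgroup (p : Fin 4 × ZMod 3) : Nat.card (lineSubgroup p) = 6 :=
  card_range_permHom (lineGen_ne_zero _) _

theorem lineSubgroup_injective : Function.Injective lineSubgroup := by
  intro p q h
  have h₁ : mk (lineGen q.1) 0 ∈ lineSubgroup p := by
    rw [h]; exact mem_range_permHom.2 ⟨1, Or.inl ⟨rfl, (one_smul _ _).symm⟩⟩
  have h₂ : mk (q.2 • lineCompl q.1) 1 ∈ lineSubgroup p := by
    rw [h]; exact mem_range_permHom.2 ⟨0, Or.inr ⟨rfl, by simp⟩⟩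
  obtain ⟨k, hk⟩ := mem_range_permHom.1 h₁
  obtain ⟨l, hl⟩ := mem_range_permHom.1 h₂
  simp only [true_and, show (1 : ZMod 2) ≠ 0 by decide, show (0 : ZMod 2) ≠ 1 by decide,
    false_and, or_false, false_or] at hk hl
  obtain ⟨i, s⟩ := p
  obtain ⟨j, t⟩ := q
  have hij : ∀ (i j : Fin 4) (k : ZMod 3), lineGen j = k • lineGen i → i = j := by decide
  obtain rfl := hij i j k hk
  have hst : ∀ (i : Fin 4) (s t l : ZMod 3),
      t • lineCompl i = s • lineCompl i + l • lineGen i → s = t := by decide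
  rw [hst i s t l hl]

theorem exists_smul_eq_lineGen {a : ZMod 3 × ZMod 3} (ha : a ≠ 0) (b : ZMod 3 × ZMod 3) :
    ∃ (i : Fin 4) (s k l : ZMod 3),
      lineGen i = k • a ∧ s • lineCompl i = b + l • a := by
  have h₁ : ∀ a : ZMod 3 × ZMod 3, a ≠ 0 →
      ∃ (i : Fin 4) (k : ZMod 3), lineGen i = k • a := by decide
  have h₂ : ∀ (i : Fin 4) (b : ZMod 3 × ZMod 3),
      ∃ s l : ZMod 3, s • lineCompl i = b + l • lineGen i := by decide
  obtain ⟨i, k, hk⟩ := h₁ a ha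
  obtain ⟨s, l, hs⟩ := h₂ i b
  exact ⟨i, s, k, l * k, hk, by rw [hs, hk, mul_smul]⟩

theorem range_permHom_le {S : Subgroup (GenDihedral A33)} {a b : ZMod 3 × ZMod 3}
    (ha : mk a 0 ∈ S) (hb : mk b 1 ∈ S) : (permHom a b).range ≤ S := by
  have hk : ∀ k : ZMod 3, mk (k • a) 0 ∈ S := by
    have h2 : mk (a + a) 0 ∈ S := mk_zero_mul a a 0 ▸ S.mul_mem ha ha
    intro k
    fin_cases k
    · convert S.one_mem using 1
      exact congrArg (mk · 0) (zero_smul (ZMod 3) a)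
    · convert ha using 2
      exact one_smul (ZMod 3) a
    · convert h2 using 2
      exact two_smul (ZMod 3) a
  intro x hx
  obtain ⟨v, e, rfl⟩ := exists_eq_mk x
  obtain ⟨k, ⟨rfl, rfl⟩ | ⟨rfl, rfl⟩⟩ := mem_range_permHom.1 hx
  · exact hk k
  · rw [add_comm, ← mk_zero_mul]
    exact S.mul_mem (hk k) hb

theorem exists_mk_mem_of_card_eq_six {S : Subgroup (GenDihedral A33)} (hS : Nat.card S = 6) :
    ∃ a b : ZMod 3 × ZMod 3, a ≠ 0 ∧ mk a 0 ∈ S ∧ mk b 1 ∈ S := by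
  have : Finite S := Nat.finite_of_card_ne_zero (by omega)
  have h01 : ∀ e : ZMod 2, e = 0 ∨ e = 1 := by decide
  have h0 : ∀ w : ZMod 3 × ZMod 3, w + w = 0 → w = 0 := by decide
  have : Fact (Nat.Prime 3) := ⟨Nat.prime_three⟩
  obtain ⟨⟨x, hxS⟩, hx⟩ := exists_prime_orderOf_dvd_card' (G := S) 3 (by rw [hS]; decide)
  obtain ⟨⟨y, hyS⟩, hy⟩ := exists_prime_orderOf_dvd_card' (G := S) 2 (by rw [hS]; decide)
  rw [Subgroup.orderOf_mk, orderOf_eq_prime_iff] at hx hy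
  obtain ⟨v, e, rfl⟩ := exists_eq_mk x
  obtain ⟨w, f, rfl⟩ := exists_eq_mk y
  obtain rfl | rfl := h01 e
  · obtain rfl | rfl := h01 f
    · simp only [pow_two, mk_zero_mul, mk_inj, one_eq_mk, and_true] at hy
      exact absurd (h0 w hy.1) (by simpa [mk_inj] using hy.2)
    · exact ⟨v, w, fun h => hx.2 (h ▸ rfl), hxS, hyS⟩
  · simp [pow_succ, mk_one_mul_mk_one, mk_zero_mul, mk_inj, one_eq_mk] at hx

theorem exists_lineSubgroup_eq {S : Subgroup (GenDihedral A33)} (hS : Nat.card S = 6) :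
    ∃ p, lineSubgroup p = S := by
  have : Finite S := Nat.finite_of_card_ne_zero (by omega)
  obtain ⟨a, b, ha, haS, hbS⟩ := exists_mk_mem_of_card_eq_six hS
  obtain ⟨i, s, k, l, hk, hl⟩ := exists_smul_eq_lineGen ha b
  have hle := range_permHom_le haS hbS
  refine ⟨(i, s), Subgroup.eq_of_le_of_card_ge (range_permHom_le (hle ?_) (hle ?_)) ?_⟩
  · exact mem_range_permHom.2 ⟨k, Or.inl ⟨rfl, hk⟩⟩
  · exact mem_range_permHom.2 ⟨l, Or.inr ⟨rfl, hl⟩⟩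
  · rw [hS, card_lineSubgroup]

/-- The subgroups of order six correspond to the cosets of the four lines. -/
noncomputable def lineSubgroupEquiv :
    Fin 4 × ZMod 3 ≃ {S : Subgroup (GenDihedral A33) // Nat.card S = 6} :=
  Equiv.ofBijective (fun p => ⟨lineSubgroup p, card_lineSubgroup p⟩)
    ⟨fun _ _ h => lineSubgroup_injective (congrArg Subtype.val h),
      fun S => (exists_lineSubgroup_eq S.2).imp fun _ h => Subtype.ext h⟩

end GenDihedral

/-- `F` has exactly 12 subgroups of order 6, and each of them is nonabelian,
hence isomorphic to the symmetric group `S₃`. -/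
theorem twelve_subgroups_order_six :
    Nat.card {S : Subgroup (GenDihedral A33) // Nat.card S = 6} = 12 ∧
    ∀ S : Subgroup (GenDihedral A33), Nat.card S = 6 →
      (¬ ∀ a b : S, a * b = b * a) ∧ Nonempty (S ≃* Equiv.Perm (Fin 3)) := by
  refine ⟨?_, fun S hS => ?_⟩
  · rw [← Nat.card_congr GenDihedral.lineSubgroupEquiv]
    simp
  · obtain ⟨p, rfl⟩ := GenDihedral.exists_lineSubgroup_eq hS
    let e : Equiv.Perm (Fin 3) ≃* GenDihedral.lineSubgroup p :=
      MonoidHom.ofInjective (GenDihedral.permHom_injective (GenDihedral.lineGen_ne_zero _) _)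
    refine ⟨fun h => ?_, ⟨e.symm⟩⟩
    have hcomm : ∀ σ τ : Equiv.Perm (Fin 3), σ * τ = τ * σ := fun σ τ =>
      e.injective (by rw [map_mul, map_mul, h])
    revert hcomm
    decide
end

section
/- Every involution of F is contained in exactly 4 subgroups of F of order 6. -/
theorem invHom_apply_of_ne_one {A : Type*} [CommGroup A] {σ : Multiplicative (ZMod 2)}
    (hσ : σ ≠ 1) (a : A) : invHom A σ a = a⁻¹ := by
  have h : σ = Multiplicative.ofAdd 1 := by revert σ; decide
  subst h
  show ((MulEquiv.inv A) ^ (1 : ZMod 2).val) a = a⁻¹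
  rw [ZMod.val_one, pow_one]
  rfl

theorem mul_eq_one_iff_of_ne_one {σ : Multiplicative (ZMod 2)} (hσ : σ ≠ 1)
    (τ : Multiplicative (ZMod 2)) : τ * σ = 1 ↔ τ ≠ 1 := by
  revert σ τ; decide

namespace GenDihedral

open SemidirectProduct

variable {A : Type*} [CommGroup A]

/-- The subgroup generated by a subgroup `B` of `A` and `x`, when `x` is a reflection. -/
def adjoinReflection (x : GenDihedral A) (B : Subgroup A) :
    Subgroup (GenDihedral A) where
  carrier := {g | (g.right = 1 ∧ g.left ∈ B) ∨ (g.right ≠ 1 ∧ g.left * x.left⁻¹ ∈ B)}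
  one_mem' := Or.inl ⟨rfl, B.one_mem⟩
  mul_mem' := by
    rintro g k (⟨hg, hgB⟩ | ⟨hg, hgB⟩) (⟨hk, hkB⟩ | ⟨hk, hkB⟩)
    · left
      simpa [hg, hk] using B.mul_mem hgB hkB
    · right
      simpa [hg, hk, mul_assoc] using B.mul_mem hgB hkB
    · right
      simpa [hg, hk, invHom_apply_of_ne_one hg, mul_right_comm] using B.mul_mem hgB (B.inv_mem hkB)
    · left
      refine ⟨(mul_eq_one_iff_of_ne_one hk _).2 hg, ?_⟩
      simpa [invHom_apply_of_ne_one hg, mul_assoc] using B.mul_mem hgB (B.inv_mem hkB)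
  inv_mem' := by
    rintro g (⟨hg, hgB⟩ | ⟨hg, hgB⟩)
    · left
      simpa [hg] using hgB
    · right
      refine ⟨inv_ne_one.2 hg, ?_⟩
      rwa [inv_left, invHom_apply_of_ne_one (inv_ne_one.2 hg), inv_inv]

theorem mem_iff_of_reflection_mem {x : GenDihedral A} (hx : x.right ≠ 1)
    {S : Subgroup (GenDihedral A)} (hS : x ∈ S) (g : GenDihedral A) :
    g ∈ S ↔ (g.right = 1 ∧ inl g.left ∈ S) ∨ (g.right ≠ 1 ∧ inl (g.left * x.left⁻¹) ∈ S) := by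
  by_cases hg : g.right = 1
  · have h : inl g.left = g := SemidirectProduct.ext rfl hg.symm
    simp [hg, h]
  · have h : inl (g.left * x.left⁻¹) = g * x := by
      refine SemidirectProduct.ext ?_ ((mul_eq_one_iff_of_ne_one hx _).2 hg).symm
      simp [invHom_apply_of_ne_one hg]
    rw [h, Subgroup.mul_mem_cancel_right S hS]
    simp [hg]

/-- The subgroups containing a reflection `x` correspond to the subgroups of `A`. -/
def subgroupEquivOfReflection (x : GenDihedral A) (hx : x.right ≠ 1) :
    {S : Subgroup (GenDihedral A) // x ∈ S} ≃ Subgroup A where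
  toFun S := S.1.comap inl
  invFun B := ⟨adjoinReflection x B, Or.inr ⟨hx, by simp⟩⟩
  left_inv S := Subtype.ext <| Subgroup.ext fun g ↦ (mem_iff_of_reflection_mem hx S.2 g).symm
  right_inv B := by
    ext a
    show (_ ∧ _) ∨ (_ ∧ _) ↔ _
    simp

theorem card_eq_two_mul_card_comap_inl {x : GenDihedral A} (hx : x.right ≠ 1)
    {S : Subgroup (GenDihedral A)} (hS : x ∈ S) :
    Nat.card S = 2 * Nat.card (S.comap (inl : A →* GenDihedral A)) := by
  let f : S →* Multiplicative (ZMod 2) := rightHom.comp S.subtype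
  have hf : Function.Surjective f := by
    intro σ
    by_cases hσ : σ = 1
    · exact ⟨1, by rw [map_one, hσ]⟩
    · refine ⟨⟨x, hS⟩, ?_⟩
      show x.right = σ
      generalize x.right = τ at hx
      revert σ τ; decide
  have hindex : f.ker.index = 2 := by
    rw [Subgroup.index_ker, MonoidHom.range_eq_top.2 hf, Subgroup.card_top]
    simp
  have hker : Nat.card f.ker = Nat.card (S.comap (inl : A →* GenDihedral A)) := by
    rw [← Subgroup.card_map_of_injective S.subtype_injective,
      ← Subgroup.card_map_of_injective (inl_injective (φ := invHom A)), Subgroup.map_comap_eq,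
      range_inl_eq_ker_rightHom, ← Subgroup.subgroupOf_map_subtype]
    rfl
  rw [← f.ker.card_mul_index, hindex, hker, mul_comm]

end GenDihedral

theorem card_subgroups_of_card_prime (p : ℕ) [Fact p.Prime] :
    Nat.card {B : Subgroup (Multiplicative (ZMod p × ZMod p)) // Nat.card B = p} = p + 1 := by
  have hp : 1 < p := (Fact.out : p.Prime).one_lt
  let e : Subgroup (Multiplicative (ZMod p × ZMod p)) ≃ Submodule (ZMod p) (ZMod p × ZMod p) :=
    (AddSubgroup.toSubgroup.symm.trans (AddSubgroup.toZModSubmodule p)).toEquiv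
  have he (B : Subgroup (Multiplicative (ZMod p × ZMod p))) : Nat.card B = p ↔ Module.finrank (ZMod p) (e B) = 1 := by
    have h : Nat.card B = Nat.card (e B) := rfl
    rw [h, Module.natCard_eq_pow_finrank (K := ZMod p), Nat.card_zmod]
    exact Nat.pow_eq_self_iff hp
  rw [Nat.card_congr ((e.subtypeEquiv he).trans (Projectivization.equivSubmodule _ _).symm),
    Projectivization.card_of_finrank_two _ _ (by simp), Nat.card_zmod]

theorem right_ne_one_of_orderOf_eq_two {x : GenDihedral A33} (hx : orderOf x = 2) :
    x.right ≠ 1 := by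
  intro h
  have hinl : SemidirectProduct.inl x.left = x := SemidirectProduct.ext rfl h.symm
  rw [← hinl, orderOf_injective _ SemidirectProduct.inl_injective] at hx
  have h3 : ∀ a : A33, a ^ 3 = 1 := by decide
  have := orderOf_dvd_of_pow_eq_one (h3 x.left)
  rw [hx] at this
  revert this
  decide

/-- Every involution of `F` lies in exactly 4 subgroups of `F` of order 6. -/
theorem involution_in_four_subgroups (x : GenDihedral A33) (hx : orderOf x = 2) :
    Nat.card {S : Subgroup (GenDihedral A33) // Nat.card S = 6 ∧ x ∈ S} = 4 := by
  have hr := right_ne_one_of_orderOf_eq_two hx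
  have e : {S : Subgroup (GenDihedral A33) // Nat.card S = 6 ∧ x ∈ S} ≃
      {B : Subgroup A33 // Nat.card B = 3} :=
    (Equiv.subtypeEquivRight fun _ ↦ and_comm).trans <|
      (Equiv.subtypeSubtypeEquivSubtypeInter (x ∈ ·)
        (fun S : Subgroup (GenDihedral A33) ↦ Nat.card S = 6)).symm.trans <|
      (GenDihedral.subgroupEquivOfReflection x hr).subtypeEquiv fun S ↦ by
        rw [GenDihedral.card_eq_two_mul_card_comap_inl hr S.2]
        show _ ↔ Nat.card (S.1.comap _) = 3
        omega
  rw [Nat.card_congr e]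
  exact card_subgroups_of_card_prime 3
end

section
/- Every subgroup of F of order 6 contains exactly 3 involutions. -/
/-- The involutions of `F` are exactly the elements outside `A`. -/
theorem orderOf_eq_two_iff_right_ne_one (x : GenDihedral A33) :
    orderOf x = 2 ↔ x.right ≠ 1 := by
  rw [orderOf_eq_prime_iff]
  obtain ⟨a, c⟩ := x
  revert a c
  simp only [pow_two, SemidirectProduct.ext_iff, SemidirectProduct.mul_left,
    SemidirectProduct.mul_right, SemidirectProduct.one_left, SemidirectProduct.one_right, ne_eq]
  decide

/-- Every subgroup of `F` of order 6 contains exactly 3 involutions. -/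
theorem three_involutions_in_subgroup (S : Subgroup (GenDihedral A33))
    (hS : Nat.card S = 6) :
    Nat.card {x : GenDihedral A33 // orderOf x = 2 ∧ x ∈ S} = 3 := by
  let f : S →* Multiplicative (ZMod 2) := SemidirectProduct.rightHom.comp S.subtype
  have hfin : Finite S := Nat.finite_of_card_ne_zero (by omega)
  have hprod : Nat.card f.ker * f.ker.index = 6 := by rw [f.ker.card_mul_index, hS]
  have hindex : f.ker.index = Nat.card f.range := Subgroup.index_ker f
  have hcod : Nat.card (Multiplicative (ZMod 2)) = 2 := by
    rw [Nat.card_congr Multiplicative.toAdd, Nat.card_zmod]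
  have hdvd : Nat.card f.range ∣ 2 :=
    (Subgroup.card_subgroup_dvd_card f.range).trans hcod.dvd
  have hne : f.ker.index ≠ 1 := by
    rw [Ne, Subgroup.index_eq_one]
    intro htop
    have : Fact (Nat.Prime 2) := ⟨Nat.prime_two⟩
    obtain ⟨x, hx⟩ := exists_prime_orderOf_dvd_card' (G := S) 2 (by rw [hS]; norm_num)
    rw [← Subgroup.orderOf_coe, orderOf_eq_two_iff_right_ne_one] at hx
    have hxker : x ∈ f.ker := htop ▸ Subgroup.mem_top x
    exact hx hxker
  have hindex_two : f.ker.index = 2 :=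
    ((Nat.dvd_prime Nat.prime_two).mp (hindex ▸ hdvd)).resolve_left hne
  have hker : Nat.card f.ker = 3 := by rw [hindex_two] at hprod; omega
  let e : {x : GenDihedral A33 // orderOf x = 2 ∧ x ∈ S} ≃ ((f.ker : Set S)ᶜ : Set S) :=
    { toFun x := ⟨⟨x.1, x.2.2⟩, (orderOf_eq_two_iff_right_ne_one x.1).mp x.2.1⟩
      invFun x := ⟨x.1.1, (orderOf_eq_two_iff_right_ne_one x.1.1).mpr x.2, x.1.2⟩ }
  have hcompl := Set.ncard_add_ncard_compl (f.ker : Set S)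
  have hker' : (f.ker : Set S).ncard = 3 := hker
  rw [Nat.card_congr e, Nat.card_coe_set_eq]
  omega
end

section
/- If S₁ and S₂ are subgroups of F of order 6 such that S₁ ∩ A ≠ S₂ ∩ A, then there exists exactly one involution of F contained in both S₁ and S₂. -/
namespace GenDihedral

variable {A : Type*} [CommGroup A]

lemma eq_one_or_eq_ofAdd_one (x : Multiplicative (ZMod 2)) :
    x = 1 ∨ x = Multiplicative.ofAdd 1 := by
  revert x; decide

lemma mul_self_of_right_ne_one {x : GenDihedral A} (hx : x.right ≠ 1) : x * x = 1 := by
  have h := (eq_one_or_eq_ofAdd_one x.right).resolve_left hx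
  have hv : (1 : ZMod 2).val = 1 := rfl
  ext
  · simp [h, invHom, hv]
  · rw [SemidirectProduct.mul_right, h]; rfl

lemma orderOf_eq_two_of_right_ne_one {x : GenDihedral A} (hx : x.right ≠ 1) :
    orderOf x = 2 :=
  orderOf_eq_prime (by rw [pow_two, mul_self_of_right_ne_one hx]) fun h => hx (by rw [h]; rfl)

lemma mul_right_eq_one {x y : GenDihedral A} (hx : x.right ≠ 1) (hy : y.right ≠ 1) :
    (x * y).right = 1 := by
  rw [SemidirectProduct.mul_right, (eq_one_or_eq_ofAdd_one x.right).resolve_left hx,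
    (eq_one_or_eq_ofAdd_one y.right).resolve_left hy]
  rfl

lemma eq_inl_of_right_eq_one {x : GenDihedral A} (hx : x.right = 1) :
    x = SemidirectProduct.inl x.left := by
  ext <;> simp [hx]

lemma right_ne_one_of_orderOf_eq_two (hA : Odd (Nat.card A)) {x : GenDihedral A}
    (hx : orderOf x = 2) : x.right ≠ 1 := by
  intro h
  rw [eq_inl_of_right_eq_one h, orderOf_injective _ SemidirectProduct.inl_injective] at hx
  have : 2 ∣ Nat.card A := hx ▸ orderOf_dvd_natCard x.left
  exact (Nat.not_even_iff_odd.2 hA) (even_iff_two_dvd.2 this)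

lemma index_range_inl :
    (SemidirectProduct.inl : A →* GenDihedral A).range.index = 2 := by
  rw [SemidirectProduct.range_inl_eq_ker_rightHom, Subgroup.index_ker,
    MonoidHom.range_eq_top.2 SemidirectProduct.rightHom_surjective, Subgroup.card_top]
  simp

lemma card_dvd_two_mul_card_comap_inl (S : Subgroup (GenDihedral A)) :
    Nat.card S ∣ 2 * Nat.card (S.comap (SemidirectProduct.inl : A →* GenDihedral A)) := by
  have : (SemidirectProduct.inl : A →* GenDihedral A).range.Normal := by
    rw [SemidirectProduct.range_inl_eq_ker_rightHom]; infer_instance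
  have h := Subgroup.relIndex_dvd_index_of_normal
    (SemidirectProduct.inl : A →* GenDihedral A).range S
  rw [index_range_inl] at h
  rw [← Subgroup.card_map_of_injective (f := (SemidirectProduct.inl : A →* GenDihedral A))
    SemidirectProduct.inl_injective, Subgroup.map_comap_eq,
    ← Subgroup.relIndex_bot_left S, ← Subgroup.relIndex_bot_left (_ ⊓ S),
    ← bot_inf_eq (SemidirectProduct.inl : A →* GenDihedral A).range,
    ← Subgroup.relIndex_inf_mul_relIndex, bot_inf_eq, mul_comm]
  exact mul_dvd_mul_right h _

lemma exists_mem_right_ne_one {S : Subgroup (GenDihedral A)} (hS : ¬ Nat.card S ∣ Nat.card A) :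
    ∃ x ∈ S, x.right ≠ 1 := by
  by_contra! h
  refine hS ?_
  rw [← Nat.card_range_of_injective
    (SemidirectProduct.inl_injective : Function.Injective (_ : A →* GenDihedral A)),
    ← MonoidHom.coe_range]
  exact Subgroup.card_dvd_of_le fun x hx => ⟨x.left, (eq_inl_of_right_eq_one (h x hx)).symm⟩

end GenDihedral

lemma Subgroup.disjoint_of_card_eq_prime {G : Type*} [Group G] {p : ℕ} (hp : p.Prime)
    {H K : Subgroup G} (hH : Nat.card H = p) (hK : Nat.card K = p) (hne : H ≠ K) :
    Disjoint H K := by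
  have := Nat.finite_of_card_ne_zero (hH ▸ hp.ne_zero)
  have := Nat.finite_of_card_ne_zero (hK ▸ hp.ne_zero)
  rw [disjoint_iff]
  rcases (Nat.dvd_prime hp).1 (hH ▸ Subgroup.card_dvd_of_le (inf_le_left : H ⊓ K ≤ H)) with h | h
  · exact Subgroup.eq_bot_of_card_eq _ h
  · exact absurd ((Subgroup.eq_of_le_of_card_ge inf_le_left (by rw [h, hH])).symm.trans
      (Subgroup.eq_of_le_of_card_ge inf_le_right (by rw [h, hK]))) hne

lemma card_A33 : Nat.card A33 = 9 := by
  simp [A33]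

lemma card_comap_inl_eq_three {S : Subgroup (GenDihedral A33)} (hS : Nat.card S = 6) :
    Nat.card (S.comap (SemidirectProduct.inl : A33 →* GenDihedral A33)) = 3 := by
  have h3 : 3 ∣ Nat.card (S.comap (SemidirectProduct.inl : A33 →* GenDihedral A33)) := by
    have h := GenDihedral.card_dvd_two_mul_card_comap_inl S
    rw [hS] at h
    omega
  have h6 : Nat.card (S.comap (SemidirectProduct.inl : A33 →* GenDihedral A33)) ∣ 6 :=
    hS ▸ Subgroup.card_comap_dvd_of_injective S _ SemidirectProduct.inl_injective
  have h9 := Subgroup.card_subgroup_dvd_card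
    (S.comap (SemidirectProduct.inl : A33 →* GenDihedral A33))
  rw [card_A33] at h9
  exact Nat.dvd_antisymm (Nat.dvd_gcd h6 h9) h3

/-- If `S₁`, `S₂` are subgroups of `F` of order 6 with `S₁ ∩ A ≠ S₂ ∩ A`, then there is
exactly one involution of `F` contained in both. -/
theorem unique_common_involution (S₁ S₂ : Subgroup (GenDihedral A33))
    (h₁ : Nat.card S₁ = 6) (h₂ : Nat.card S₂ = 6)
    (hne : S₁ ⊓ (SemidirectProduct.inl : A33 →* GenDihedral A33).range ≠
           S₂ ⊓ (SemidirectProduct.inl : A33 →* GenDihedral A33).range) :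
    ∃! x : GenDihedral A33, orderOf x = 2 ∧ x ∈ S₁ ∧ x ∈ S₂ := by
  have c₁ := card_comap_inl_eq_three h₁
  have c₂ := card_comap_inl_eq_three h₂
  have hd := Subgroup.disjoint_of_card_eq_prime Nat.prime_three c₁ c₂ fun h => hne <| by
    rw [inf_comm, ← Subgroup.map_comap_eq, h, Subgroup.map_comap_eq, inf_comm]
  refine existsUnique_of_exists_of_unique ?_ ?_
  · have hc := Subgroup.isComplement'_of_card_mul_and_disjoint (by rw [c₁, c₂, card_A33]) hd
    obtain ⟨t₁, ht₁, hr₁⟩ := GenDihedral.exists_mem_right_ne_one (S := S₁)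
      (by rw [h₁, card_A33]; decide)
    obtain ⟨t₂, ht₂, hr₂⟩ := GenDihedral.exists_mem_right_ne_one (S := S₂)
      (by rw [h₂, card_A33]; decide)
    obtain ⟨⟨⟨a, ha⟩, ⟨b, hb⟩⟩, hab⟩ := hc.2 (t₁ * t₂).left
    have ht : t₁ * t₂ = SemidirectProduct.inl a * SemidirectProduct.inl b := by
      rw [GenDihedral.eq_inl_of_right_eq_one (GenDihedral.mul_right_eq_one hr₁ hr₂), ← hab, map_mul]
    have hx : (SemidirectProduct.inl a)⁻¹ * t₁ = SemidirectProduct.inl b * t₂⁻¹ := by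
      rw [eq_mul_inv_iff_mul_eq, mul_assoc, ht, inv_mul_cancel_left]
    exact ⟨(SemidirectProduct.inl a)⁻¹ * t₁,
      GenDihedral.orderOf_eq_two_of_right_ne_one (by simpa using hr₁),
      S₁.mul_mem (S₁.inv_mem ha) ht₁, hx ▸ S₂.mul_mem hb (S₂.inv_mem ht₂)⟩
  · rintro x y ⟨hx, hx₁, hx₂⟩ ⟨hy, hy₁, hy₂⟩
    have hodd : Odd (Nat.card A33) := by rw [card_A33]; decide
    have hrx := GenDihedral.right_ne_one_of_orderOf_eq_two hodd hx
    have hry := GenDihedral.right_ne_one_of_orderOf_eq_two hodd hy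
    have hxy := GenDihedral.eq_inl_of_right_eq_one (GenDihedral.mul_right_eq_one hrx hry)
    have h1 : (x * y).left = 1 := Subgroup.disjoint_def.1 hd
      (show _ ∈ S₁ from hxy ▸ S₁.mul_mem hx₁ hy₁) (show _ ∈ S₂ from hxy ▸ S₂.mul_mem hx₂ hy₂)
    rw [h1, map_one, ← GenDihedral.mul_self_of_right_ne_one hry] at hxy
    exact mul_right_cancel hxy
end
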